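/- For every nonnegative integer n, the number of square-lattice walks of length 2n that start at (−1,0), end at (0,−1), and are confined to the three-quadrant cone C equals (2 · 16^n / 3) · ( (1/2)_n (7/6)_n / ( (2)_n (4/3)_n ) − (1/2)_n (5/6)_n / ( (2)_n (5/3)_n ) ). -/

import Mathlib

/-- Square-lattice steps. -/
def squareSteps : Set (ℤ × ℤ) := {(1,0), (-1,0), (0,1), (0,-1)}

/-- Diagonal-lattice steps. -/
def diagSteps : Set (ℤ × ℤ) := {(1,1), (1,-1), (-1,1), (-1,-1)}

/-- The three-quadrant cone `C = {(i,j) : i ≥ 0 or j ≥ 0}`. -/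
def coneC : Set (ℤ × ℤ) := {p | 0 ≤ p.1 ∨ 0 ≤ p.2}

/-- The quadrant `Q = {(i,j) : i ≥ 0 and j ≥ 0}`. -/
def quadQ : Set (ℤ × ℤ) := {p | 0 ≤ p.1 ∧ 0 ≤ p.2}

/-- Number of walks of length `n` with steps in `steps`, from `a` to `b`,
confined to `region`. -/
noncomputable def walkCount (steps region : Set (ℤ × ℤ)) (a b : ℤ × ℤ) (n : ℕ) : ℕ :=
  Nat.card {w : Fin (n+1) → ℤ × ℤ //
    w 0 = a ∧ w (Fin.last n) = b ∧
    (∀ k : Fin n, w k.succ - w k.castSucc ∈ steps) ∧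
    (∀ k, w k ∈ region)}

/-- Ascending factorial (Pochhammer symbol) `(a)ₙ = a(a+1)⋯(a+n-1)`. -/
noncomputable def poch (a : ℚ) (n : ℕ) : ℚ := (ascPochhammer ℚ n).eval a

/-- Polynomials in `x` (outer variable) and `y` (inner variable). -/
abbrev BiPoly := Polynomial (Polynomial ℚ)

/-- Power series in the length variable `t` with coefficients polynomial in `x` and `y`. -/
abbrev BiSeries := PowerSeries BiPoly

namespace BiSeries

/-- The variable `x`. -/
noncomputable def x : BiSeries := PowerSeries.C Polynomial.X

/-- The variable `y`. -/
noncomputable def y : BiSeries := PowerSeries.C (Polynomial.C Polynomial.X)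

/-- The length variable `t`. -/
noncomputable def t : BiSeries := PowerSeries.X

/-- The substitution `x = 0` on polynomials. -/
noncomputable def polyX0 : BiPoly →+* BiPoly := Polynomial.C.comp Polynomial.constantCoeff

/-- The substitution `y = 0` on polynomials. -/
noncomputable def polyY0 : BiPoly →+* BiPoly :=
  Polynomial.mapRingHom (Polynomial.C.comp Polynomial.constantCoeff)

/-- The substitution `x = 0`. -/
noncomputable def ex : BiSeries →+* BiSeries := PowerSeries.map polyX0

/-- The substitution `y = 0`. -/
noncomputable def ey : BiSeries →+* BiSeries := PowerSeries.map polyY0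

lemma polyX0_apply (p : BiPoly) : polyX0 p = Polynomial.C (p.coeff 0) := by
  simp [polyX0]

lemma coeff_polyY0 (p : BiPoly) (i : ℕ) :
    (polyY0 p).coeff i = Polynomial.C ((p.coeff i).coeff 0) := by
  simp [polyY0]

lemma polyX0_polyY0 (p : BiPoly) : polyX0 (polyY0 p) = polyY0 (polyX0 p) := by
  ext i j
  simp only [polyX0_apply, coeff_polyY0, Polynomial.coeff_C]
  split_ifs <;> simp_all [Polynomial.coeff_C]

@[simp] lemma ex_x : ex x = 0 := by simp [ex, x, polyX0]
@[simp] lemma ex_y : ex y = y := by simp [ex, y, polyX0]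
@[simp] lemma ex_t : ex t = t := by simp [ex, t]
@[simp] lemma ey_x : ey x = x := by simp [ey, x, polyY0]
@[simp] lemma ey_y : ey y = 0 := by simp [ey, y, polyY0]
@[simp] lemma ey_t : ey t = t := by simp [ey, t]

@[simp] lemma ex_ex (f : BiSeries) : ex (ex f) = ex f := by
  ext n : 1
  simp [ex, polyX0_apply]

@[simp] lemma ey_ey (f : BiSeries) : ey (ey f) = ey f := by
  ext n i : 2
  simp [ey, coeff_polyY0]

lemma ey_ex (f : BiSeries) : ey (ex f) = ex (ey f) := by
  ext n : 1
  simp [ex, ey, polyX0_polyY0]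

lemma x_ne_zero : x ≠ 0 := by
  intro h
  have := congrArg PowerSeries.constantCoeff h
  simp [x] at this

lemma t_ne_zero : t ≠ 0 := PowerSeries.X_ne_zero

lemma one_add_y_ne_zero : 1 + y ≠ 0 := by
  intro h
  have := congrArg ey h
  simp at this

/-- Coefficientwise removal of the constant term in `x` followed by division by `x`. -/
noncomputable def divx (f : BiSeries) : BiSeries :=
  PowerSeries.mk fun n => (PowerSeries.coeff n f).divX

lemma x_mul_divx (f : BiSeries) : x * divx f = f - ex f := by
  ext n : 1
  simp only [x, divx, ex, PowerSeries.coeff_C_mul, PowerSeries.coeff_mk, map_sub,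
    PowerSeries.coeff_map, polyX0_apply]
  rw [eq_sub_iff_add_eq, Polynomial.X_mul_divX_add]

lemma exists_eq_x_mul {f : BiSeries} (h : ex f = 0) : ∃ g, f = x * g :=
  ⟨divx f, by rw [x_mul_divx, h, sub_zero]⟩

/-- The kernel `xy - t(1+y)(1+x²y)` of Gessel's step set. -/
noncomputable def ker : BiSeries := x * y - t * ((1 + y) * (1 + x ^ 2 * y))

@[simp] lemma ex_ker : ex ker = -(t * (1 + y)) := by simp [ker]
@[simp] lemma ey_ker : ey ker = -t := by simp [ker]

/-- A class of series stable under division by `t`, all of whose members are divisible by `t`,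
is trivial. -/
lemma eq_zero_of_descent (p : BiSeries → Prop)
    (h0 : ∀ H, p H → PowerSeries.constantCoeff H = 0) (h1 : ∀ H, p (t * H) → p H)
    (H : BiSeries) (hH : p H) : H = 0 := by
  have key : ∀ n, ∀ H, p H → PowerSeries.coeff n H = 0 := by
    intro n
    induction n with
    | zero => intro H hH; simpa using h0 H hH
    | succ n ih =>
      intro H hH
      obtain ⟨H', rfl⟩ := PowerSeries.X_dvd_iff.mpr (h0 H hH)
      rw [PowerSeries.coeff_succ_X_mul]
      exact ih H' (h1 H' hH)
  ext n : 1
  simpa using key n H hH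

/-- Uniqueness for the functional equation behind the quadratic relation. -/
lemma eq_zero_of_quadratic_equation (H : BiSeries)
    (h : ker * H = -(t * (1 + y) ^ 2 * (ey H - ex (ey H))) - t * (1 + y) * ex H) : H = 0 := by
  refine eq_zero_of_descent (fun H => ker * H =
    -(t * (1 + y) ^ 2 * (ey H - ex (ey H))) - t * (1 + y) * ex H) ?_ ?_ H h
  · intro H h
    have := congrArg PowerSeries.constantCoeff h
    simpa [ker, t, x, y] using this
  · intro H h
    simp only [map_mul, ex_t, ey_t] at h
    apply mul_left_cancel₀ t_ne_zero
    linear_combination h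

/-- Uniqueness for the functional equation behind the bilinear relation. -/
lemma eq_zero_of_bilinear_equation (H : BiSeries)
    (h : 2 * (ker * H) = -(2 * (t * (1 - y ^ 2) * ey H))
      - (2 * t * (1 + x ^ 2) - x) * (1 + y) * ex H) : H = 0 := by
  refine eq_zero_of_descent (fun H => 2 * (ker * H) = -(2 * (t * (1 - y ^ 2) * ey H))
      - (2 * t * (1 + x ^ 2) - x) * (1 + y) * ex H) ?_ ?_ H h
  · intro H h
    have h2 := congrArg PowerSeries.constantCoeff h
    have hx : PowerSeries.constantCoeff (ex H) = polyX0 (PowerSeries.constantCoeff H) := by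
      rw [ex, ← PowerSeries.coeff_zero_eq_constantCoeff_apply, PowerSeries.coeff_map,
        PowerSeries.coeff_zero_eq_constantCoeff_apply]
    simp only [ker, t, x, y, map_mul, map_sub, map_neg, map_add, map_one, map_pow,
      PowerSeries.constantCoeff_X, PowerSeries.constantCoeff_C, hx, map_ofNat] at h2
    set P := PowerSeries.constantCoeff H
    have h3 : 2 * (Polynomial.C Polynomial.X * P)
        = (1 + Polynomial.C Polynomial.X) * polyX0 P := by
      apply mul_left_cancel₀ (Polynomial.X_ne_zero (R := Polynomial ℚ))
      linear_combination h2
    have h4 := congrArg polyX0 h3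
    have h5 : polyX0 P = 0 := by
      have hne : (Polynomial.C Polynomial.X - 1 : BiPoly) ≠ 0 := by
        intro h
        have := congrArg (fun p => (p.coeff 0).coeff 0) h
        simp at this
      apply mul_left_cancel₀ hne
      have e1 : polyX0 (polyX0 P) = polyX0 P := by simp [polyX0_apply]
      have e2 : polyX0 (Polynomial.C Polynomial.X) = Polynomial.C Polynomial.X := by
        simp [polyX0_apply]
      simp only [map_mul, map_add, map_one, map_ofNat, e1, e2] at h4
      linear_combination h4
    rw [h5, mul_zero] at h3
    simpa using h3
  · intro H h
    simp only [map_mul, ex_t, ey_t] at h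
    apply mul_left_cancel₀ t_ne_zero
    linear_combination h

lemma ex_eq_zero_of_ker_mul {Z H : BiSeries} (h : ex Z = 0) (hk : Z = ker * H) : ex H = 0 := by
  have := congrArg ex hk
  rw [h, map_mul, ex_ker] at this
  have h2 : t * (1 + y) ≠ 0 := mul_ne_zero t_ne_zero one_add_y_ne_zero
  simpa [h2, t_ne_zero, one_add_y_ne_zero] using this

lemma eq_zero_of_quadratic_congruence {Z Z₁ Ψ H : BiSeries} (hZ : Z = x * Z₁) (hZ₁ : ex Z₁ = 0)
    (hyZ : ey Z = Z) (hxΨ : ex Ψ = Ψ) (hyΨ : ey Ψ = 0)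
    (h : t ^ 2 * (1 + y) ^ 2 * Z - x ^ 2 * Ψ = ker * H) : Z = 0 := by
  obtain ⟨H₁, rfl⟩ := exists_eq_x_mul (ex_eq_zero_of_ker_mul (by simp [hZ]) h)
  have h1 : t ^ 2 * (1 + y) ^ 2 * Z₁ - x * Ψ = ker * H₁ := by
    apply mul_left_cancel₀ x_ne_zero
    rw [hZ] at h
    linear_combination h
  obtain ⟨H₂, rfl⟩ := exists_eq_x_mul (ex_eq_zero_of_ker_mul (by simp [hZ₁]) h1)
  have hy := congrArg ey h
  simp only [map_sub, map_mul, map_pow, map_add, map_one, ey_t, ey_y, ey_x, hyZ, hyΨ, ey_ker] at hy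
  have hy1 : t * Z₁ = -(x * ey H₂) := by
    apply mul_left_cancel₀ (mul_ne_zero t_ne_zero x_ne_zero)
    rw [hZ] at hy
    linear_combination hy
  have h2 : -(t * (1 + y) ^ 2 * ey H₂) - Ψ = ker * H₂ := by
    apply mul_left_cancel₀ x_ne_zero
    linear_combination h1 - t * (1 + y) ^ 2 * hy1
  have h3 := congrArg ex h2
  simp only [map_sub, map_mul, map_pow, map_add, map_one, map_neg, ex_t, ex_y, hxΨ, ex_ker] at h3
  have := eq_zero_of_quadratic_equation H₂ (by linear_combination h3 - h2)
  subst this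
  simpa [t_ne_zero, hZ, x_ne_zero] using hy1

lemma eq_zero_of_bilinear_congruence {Z Z₁ Ψ H : BiSeries} (hZ : Z = x * Z₁) (hZ₁ : ex Z₁ = 0)
    (hyZ : ey Z = Z) (hxΨ : ex Ψ = Ψ) (hyΨ : ey Ψ = 0)
    (h : t * (1 - y ^ 2) * Z + (2 * t * (1 + x ^ 2) - x) * (x * Ψ) = ker * H) : Z = 0 := by
  obtain ⟨H₁, rfl⟩ := exists_eq_x_mul (ex_eq_zero_of_ker_mul (by simp [hZ]) h)
  have hy := congrArg ey h
  simp only [map_sub, map_mul, map_pow, map_add, map_one, map_ofNat, ey_t, ey_y, ey_x, hyZ, hyΨ,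
    ey_ker] at hy
  have hy1 : Z₁ = -(ey H₁) := by
    apply mul_left_cancel₀ (mul_ne_zero t_ne_zero x_ne_zero)
    rw [hZ] at hy
    linear_combination hy
  have h1 : -(t * (1 - y ^ 2) * ey H₁) + (2 * t * (1 + x ^ 2) - x) * Ψ = ker * H₁ := by
    apply mul_left_cancel₀ x_ne_zero
    rw [hZ] at h
    linear_combination h - t * (1 - y ^ 2) * x * hy1
  have hxy : ex (ey H₁) = 0 := by rw [← neg_eq_zero, ← map_neg, ← hy1, hZ₁]
  have h3 := congrArg ex h1
  simp only [map_sub, map_mul, map_pow, map_add, map_one, map_neg, map_ofNat, ex_t, ex_y, ex_x,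
    hxΨ, hxy, ex_ker] at h3
  have h4 : 2 * Ψ = -((1 + y) * ex H₁) := by
    apply mul_left_cancel₀ t_ne_zero
    linear_combination h3
  have := eq_zero_of_bilinear_equation H₁
    (by linear_combination -2 * h1 + (2 * t * (1 + x ^ 2) - x) * h4)
  subst this
  rw [hZ, hy1, map_zero, neg_zero, mul_zero]

/-- Coefficientwise removal of the constant term in `y` followed by division by `y`. -/
noncomputable def divY (p : BiPoly) : BiPoly := p.sum fun i q => Polynomial.monomial i q.divX

lemma coeff_divY (p : BiPoly) (i : ℕ) : (divY p).coeff i = (p.coeff i).divX := by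
  rw [divY, Polynomial.sum_def, Polynomial.finsetSum_coeff]
  simp only [Polynomial.coeff_monomial, Finset.sum_ite_eq']
  split_ifs with h
  · rfl
  · simp [Polynomial.notMem_support_iff.mp h]

lemma y_mul_divY (p : BiPoly) : Polynomial.C Polynomial.X * divY p = p - polyY0 p := by
  ext i : 1
  rw [Polynomial.coeff_C_mul, coeff_divY, Polynomial.coeff_sub, coeff_polyY0, eq_sub_iff_add_eq,
    Polynomial.X_mul_divX_add]

/-- One Gessel step inside the quadrant. -/
noncomputable def stepPoly (p : BiPoly) : BiPoly :=
  Polynomial.X * p + Polynomial.C Polynomial.X * (Polynomial.X * p) + p.divX + divY p.divX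

/-- Gessel walks in the quadrant starting at `(1,0)`, weighted by `1 + τ` for each visit to the
axis `x = 0`. -/
noncomputable def walkPoly (τ : ℚ) : ℕ → BiPoly
  | 0 => Polynomial.X
  | n + 1 => stepPoly (walkPoly τ n)
      + Polynomial.C (Polynomial.C τ) * polyX0 (stepPoly (walkPoly τ n))

lemma y_mul_polyX0_stepPoly (p : BiPoly) :
    Polynomial.C Polynomial.X * polyX0 (stepPoly p) =
      (1 + Polynomial.C Polynomial.X) * polyX0 p.divX - polyY0 (polyX0 p.divX) := by
  have h := congrArg polyX0 (y_mul_divY p.divX)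
  have e1 : polyX0 (Polynomial.C Polynomial.X) = Polynomial.C Polynomial.X := by
    simp [polyX0_apply]
  have e2 : polyX0 Polynomial.X = 0 := by simp [polyX0_apply]
  simp only [map_mul, map_sub, e1] at h
  simp only [stepPoly, map_add, map_mul, e1, e2, ← polyX0_polyY0]
  linear_combination h

lemma xy_mul_stepPoly (p : BiPoly) :
    Polynomial.X * Polynomial.C Polynomial.X * stepPoly p =
      Polynomial.X ^ 2 * Polynomial.C Polynomial.X * (1 + Polynomial.C Polynomial.X) * p
      + (1 + Polynomial.C Polynomial.X) * (p - polyX0 p) - polyY0 (p - polyX0 p) := by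
  have hx : Polynomial.X * p.divX = p - polyX0 p := by
    rw [eq_sub_iff_add_eq, polyX0_apply, Polynomial.X_mul_divX_add]
  have h := y_mul_divY p.divX
  have e : polyY0 Polynomial.X = Polynomial.X := by simp [polyY0]
  have hx2 := congrArg polyY0 hx
  rw [map_mul, e] at hx2
  rw [stepPoly, ← hx2]
  linear_combination (1 + Polynomial.C Polynomial.X) * hx + Polynomial.X * h

/-- The generating function of the polynomials `walkPoly τ n`. -/
noncomputable def walkSeries (τ : ℚ) : BiSeries := PowerSeries.mk (walkPoly τ)

/-- Rational constants. -/
noncomputable def const (τ : ℚ) : BiSeries := PowerSeries.C (Polynomial.C (Polynomial.C τ))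

lemma y_mul_ex_walkSeries (τ : ℚ) :
    y * ex (walkSeries τ) = t * ((1 + const τ) *
      ((1 + y) * ex (divx (walkSeries τ)) - ey (ex (divx (walkSeries τ))))) := by
  ext n : 1
  have e : (1 + const τ) = PowerSeries.C (1 + Polynomial.C (Polynomial.C τ)) := by simp [const]
  have e2 : (1 + y) = PowerSeries.C (1 + Polynomial.C Polynomial.X) := by simp [y]
  rw [e, e2, y, PowerSeries.coeff_C_mul]
  cases n with
  | zero => simp [t, walkSeries, ex, walkPoly, polyX0_apply]
  | succ n =>
    rw [t, PowerSeries.coeff_succ_X_mul, PowerSeries.coeff_C_mul, map_sub, PowerSeries.coeff_C_mul]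
    simp only [ex, ey, PowerSeries.coeff_map, walkSeries, divx, PowerSeries.coeff_mk, walkPoly,
      map_add, map_mul]
    rw [← y_mul_polyX0_stepPoly]
    have e3 : polyX0 (Polynomial.C (Polynomial.C τ)) = Polynomial.C (Polynomial.C τ) := by
      simp [polyX0_apply]
    have e4 : ∀ p, polyX0 (polyX0 p) = polyX0 p := by simp [polyX0_apply]
    rw [e3, e4]
    ring

lemma xy_mul_walkSeries (τ : ℚ) :
    x * y * walkSeries τ = x ^ 2 * y + t * (x ^ 2 * y * (1 + y) * walkSeries τ
      + (1 + y) * (walkSeries τ - ex (walkSeries τ)) - ey (walkSeries τ - ex (walkSeries τ))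
      + const τ * x *
        ((1 + y) * ex (divx (walkSeries τ)) - ey (ex (divx (walkSeries τ))))) := by
  ext n : 1
  have e1 : x * y = PowerSeries.C (Polynomial.X * Polynomial.C Polynomial.X) := by
    simp only [x, y, map_mul]
  have e2 : (1 + y) = PowerSeries.C (1 + Polynomial.C Polynomial.X) := by simp [y]
  have e3 : x ^ 2 * y = PowerSeries.C (Polynomial.X ^ 2 * Polynomial.C Polynomial.X) := by
    simp only [x, y, map_mul, map_pow]
  have e4 : x ^ 2 * y * (1 + y) = PowerSeries.C (Polynomial.X ^ 2 * Polynomial.C Polynomial.X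
      * (1 + Polynomial.C Polynomial.X)) := by
    simp only [x, y, map_mul, map_pow, map_add, map_one]
  have e5 : const τ * x = PowerSeries.C (Polynomial.C (Polynomial.C τ) * Polynomial.X) := by
    simp [x, const]
  rw [e4, e5, e1, e2, e3, PowerSeries.coeff_C_mul]
  cases n with
  | zero =>
    simp [t, walkSeries, walkPoly]
    ring
  | succ n =>
    rw [map_add, t, PowerSeries.coeff_succ_X_mul, PowerSeries.coeff_C, if_neg n.succ_ne_zero]
    simp only [map_add (PowerSeries.coeff (R := BiPoly) n),
      map_sub (PowerSeries.coeff (R := BiPoly) n), PowerSeries.coeff_C_mul, ex, ey,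
      PowerSeries.coeff_map, walkSeries, divx, PowerSeries.coeff_mk, walkPoly, mul_add]
    rw [xy_mul_stepPoly, map_sub]
    linear_combination Polynomial.C (Polynomial.C τ) * Polynomial.X * y_mul_polyX0_stepPoly
      (walkPoly τ n)

/-- Generating function of Gessel walks killed on the axis `x = 0`. -/
noncomputable def killed : BiSeries := walkSeries (-1)

/-- Generating function of reflected Gessel walks that end off the axis `x = 0`. -/
noncomputable def reflected : BiSeries := walkSeries 1 - ex (walkSeries 1)

/-- Generating function of reflected Gessel walks that end on the axis `x = 0`. -/
noncomputable def diagonal : BiSeries := ex (walkSeries 1)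

lemma ex_killed : ex killed = 0 := by
  have h := y_mul_ex_walkSeries (-1)
  have e : 1 + const (-1) = 0 := by simp [const]
  have hy : y ≠ 0 := by
    intro h
    have := congrArg PowerSeries.constantCoeff h
    simp [y] at this
  rw [e, zero_mul, mul_zero] at h
  simpa [hy, killed] using h

lemma ker_mul_killed : ker * killed = x ^ 2 * y - t * ey killed
    - t * x * ((1 + y) * ex (divx killed) - ey (ex (divx killed))) := by
  have h := xy_mul_walkSeries (-1)
  have h2 := ex_killed
  have e : const (-1) = -1 := by simp [const]
  simp only [killed] at h2 ⊢
  rw [h2, e, sub_zero] at h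
  rw [ker]
  linear_combination h

lemma two_mul_ker_mul_reflected : 2 * (ker * reflected) = 2 * (x ^ 2 * y - t * ey reflected)
    - x * y * (1 - 2 * (t * x * (1 + y))) * diagonal := by
  have h := xy_mul_walkSeries 1
  have h2 := y_mul_ex_walkSeries 1
  have e : const 1 = 1 := by simp [const]
  rw [e] at h h2
  rw [ker, reflected, diagonal]
  linear_combination 2 * h - x * h2

/-- The series `1 + t G(x,0)` for killed walks. -/
noncomputable def killedRow : BiSeries := 1 + t * ey killed

/-- The series `1 - t U(x,0)` for reflected walks. -/
noncomputable def reflectedRow : BiSeries := 1 - t * ey reflected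

/-- Killed walks ending at `(1,0)`. -/
noncomputable def killedCorner : BiSeries := ex (ey (divx killed))

/-- Reflected walks ending at `(1,0)`. -/
noncomputable def reflectedCorner : BiSeries := ex (ey (divx reflected))

/-- The `y`-side counterpart of `killedRow`. -/
noncomputable def killedColumn : BiSeries :=
  y - t ^ 2 * (1 + y) * ((1 + y) * ex (divx killed) - ey (ex (divx killed)))

/-- The `y`-side counterpart of `reflectedRow`. -/
noncomputable def reflectedColumn : BiSeries := 2 + t * (1 + y) * diagonal

lemma killedRow_congruence : t * (1 + y) * killedRow =
    x * killedColumn - ker * (1 + t * (1 + y) * killed) := by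
  have h := ker_mul_killed
  rw [killedRow, killedColumn]
  linear_combination (t * (1 + y)) * h + (by rw [ker] :
    ker = x * y - t * ((1 + y) * (1 + x ^ 2 * y)))

lemma reflectedRow_congruence : 2 * reflectedRow =
    (1 - x ^ 2 * y) * reflectedColumn + ker * (2 * reflected + diagonal) := by
  have h := two_mul_ker_mul_reflected
  rw [reflectedRow, reflectedColumn]
  linear_combination -h - diagonal * (by rw [ker] :
    ker = x * y - t * ((1 + y) * (1 + x ^ 2 * y)))

lemma killedRow_eq : killedRow = 1 + x * (t * ey (divx killed)) := by
  have h := congrArg ey (x_mul_divx killed)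
  rw [ex_killed, sub_zero, map_mul, ey_x] at h
  rw [killedRow]
  linear_combination -t * h

lemma ex_reflected : ex reflected = 0 := by simp [reflected]

lemma reflectedRow_eq : reflectedRow = 1 - x * (t * ey (divx reflected)) := by
  have h := congrArg ey (x_mul_divx reflected)
  rw [ex_reflected, sub_zero, map_mul, ey_x] at h
  rw [reflectedRow]
  linear_combination t * h

lemma ex_killedColumn : ex killedColumn = killedColumn := by
  simp [killedColumn, ← ey_ex]

lemma ey_killedColumn : ey killedColumn = 0 := by simp [killedColumn]

lemma ex_reflectedColumn : ex reflectedColumn = reflectedColumn := by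
  simp [reflectedColumn, diagonal, map_ofNat]

lemma ey_killedRow : ey killedRow = killedRow := by simp [killedRow]

lemma ey_reflectedRow : ey reflectedRow = reflectedRow := by simp [reflectedRow]

lemma ofNat_ne_zero (n : ℕ) [n.AtLeastTwo] : (ofNat(n) : BiSeries) ≠ 0 := by
  intro h
  have := congrArg PowerSeries.constantCoeff h
  rw [map_ofNat, map_zero] at this
  exact OfNat.ofNat_ne_zero n this

theorem reflectedRow_sq : reflectedRow ^ 2 =
    killedRow * (killedRow - 2 * t * (killedCorner + reflectedCorner) * x) := by
  set c := 2 * t * (killedCorner + reflectedCorner) with hc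
  have hxc : ex c = c := by simp [hc, map_ofNat, killedCorner, reflectedCorner]
  have hyc : ey c = c := by simp [hc, map_ofNat, killedCorner, reflectedCorner, ey_ex]
  have hk : t * ((1 + y) * (1 + x ^ 2 * y)) = x * y - ker := by rw [ker]; ring
  have a := killedRow_congruence
  have b := reflectedRow_congruence
  set g := 1 + t * (1 + y) * killed
  set j := 2 * reflected + diagonal
  set E := reflectedColumn with hE
  set m := killedColumn with hm
  have key := eq_zero_of_quadratic_congruence
    (Z := 4 * (reflectedRow ^ 2 - killedRow * (killedRow - c * x)))
    (Z₁ := 4 * ((-2 * (t * ey (divx reflected)) + x * (t * ey (divx reflected)) ^ 2)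
      - 2 * (t * ey (divx killed)) - x * (t * ey (divx killed)) ^ 2
      + c * (1 + x * (t * ey (divx killed)))))
    (Ψ := y * E ^ 2 * (y - 4 * t ^ 2 * (1 + y) ^ 2) - 4 * m * (m - t * c * (1 + y)))
    (H := E ^ 2 * (ker - 2 * x * y) + t ^ 2 * (1 + y) ^ 2 * (2 * (1 - x ^ 2 * y) * E * j
      + ker * j ^ 2) + 4 * g * (2 * x * m - t * c * (1 + y) * x) - 4 * ker * g ^ 2)
    (by rw [killedRow_eq, reflectedRow_eq]; ring)
    (by
      simp only [map_mul, map_add, map_sub, map_neg, map_pow, map_ofNat, ex_x, ex_t, map_one, hxc]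
      rw [hc, killedCorner, reflectedCorner]
      ring)
    (by simp [ey_killedRow, ey_reflectedRow, hyc, map_ofNat])
    (by simp [hE, hm, ex_reflectedColumn, ex_killedColumn, hxc, map_ofNat])
    (by simp [hm, ey_killedColumn])
    (by
      linear_combination
        (t * (1 + y)) ^ 2 * (2 * reflectedRow + (1 - x ^ 2 * y) * E + ker * j) * b
        - 4 * (t * (1 + y) * killedRow + x * m - ker * g) * a
        + 4 * t * (1 + y) * c * x * a
        + E ^ 2 * (t * ((1 + y) * (1 + x ^ 2 * y)) + x * y - ker) * hk)
  rw [mul_eq_zero, or_iff_right (ofNat_ne_zero 4)] at key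
  linear_combination key

theorem reflectedRow_mul : reflectedRow * (2 * t * killedRow
    - (1 - 2 * t ^ 2 * reflectedCorner) * x) = (2 * t * (1 + x ^ 2) - x) * killedRow := by
  set c := 1 - 2 * t ^ 2 * reflectedCorner with hc
  have hxc : ex c = c := by simp [hc, map_ofNat, reflectedCorner]
  have hyc : ey c = c := by simp [hc, map_ofNat, reflectedCorner, ey_ex]
  have hk : t * ((1 + y) * (1 + x ^ 2 * y)) = x * y - ker := by rw [ker]; ring
  have a := killedRow_congruence
  have b := reflectedRow_congruence
  set g := 1 + t * (1 + y) * killed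
  set j := 2 * reflected + diagonal
  set E := reflectedColumn with hE
  set m := killedColumn with hm
  set D := 2 * t * (1 + x ^ 2) - x with hD
  have b2 : t * (1 - y) * (2 * reflectedRow) = -(y * D * E) + ker * (t * (1 - y) * j - E) := by
    rw [hD]
    linear_combination t * (1 - y) * b + E * hk
  have key := eq_zero_of_bilinear_congruence
    (Z := 2 * (reflectedRow * (2 * t * killedRow - c * x) - D * killedRow))
    (Z₁ := 2 * (2 * t * (t * ey (divx killed)) - c - 2 * t * (t * ey (divx reflected))
      - x * (t * ey (divx reflected)) * (2 * t * (t * ey (divx killed)) - c) + 1 - 2 * t * x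
      - 2 * t * (t * ey (divx killed)) * (1 + x ^ 2) + x * (t * ey (divx killed))))
    (Ψ := y * E * (2 * m - c * (1 + y)) + 2 * (1 - y) * m)
    (H := (t * (1 - y) * j - E) * (x * (2 * m - c * (1 + y)) - 2 * ker * g)
      + 2 * g * y * D * E + 2 * (1 - y) * D * g)
    (by rw [killedRow_eq, reflectedRow_eq, hD]; ring)
    (by
      simp only [map_mul, map_add, map_sub, map_pow, map_ofNat, ex_x, ex_t, map_one, hxc]
      rw [hc, reflectedCorner]
      ring)
    (by simp [hD, ey_killedRow, ey_reflectedRow, hyc, map_ofNat])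
    (by simp [hE, hm, ex_reflectedColumn, ex_killedColumn, hxc, map_ofNat])
    (by simp [hm, ey_killedColumn])
    (by
      apply mul_left_cancel₀ t_ne_zero
      linear_combination (2 * t * (x * m - ker * g) - c * t * (1 + y) * x) * b2
        + (t * (1 - y) * (2 * reflectedRow)) * 2 * t * a - 2 * t * (1 - y) * D * a)
  rw [mul_eq_zero, or_iff_right (ofNat_ne_zero 2)] at key
  linear_combination key

/-- The equation with one catalytic variable satisfied by `killedRow`. -/
theorem killedRow_equation :
    (killedRow - 2 * t * (killedCorner + reflectedCorner) * x)
      * (2 * t * killedRow - (1 - 2 * t ^ 2 * reflectedCorner) * x) ^ 2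
      = (2 * t * (1 + x ^ 2) - x) ^ 2 * killedRow := by
  have hne : killedRow ≠ 0 := by
    intro h
    have := congrArg PowerSeries.constantCoeff h
    simp [killedRow, t] at this
  apply mul_left_cancel₀ hne
  rw [← mul_assoc, ← reflectedRow_sq, ← mul_pow, reflectedRow_mul]
  ring

open PowerSeries

/-- The coefficient of `x ^ 0 y ^ 0`, as a series in `t`. -/
noncomputable def corner : BiSeries →+* ℚ⟦X⟧ :=
  PowerSeries.map (Polynomial.constantCoeff.comp Polynomial.constantCoeff)

/-- The substitution `x = e`, `y = 0`. -/
noncomputable def spec (e : ℚ) : BiSeries →+* ℚ⟦X⟧ :=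
  PowerSeries.map ((Polynomial.evalRingHom e).comp
    (Polynomial.mapRingHom Polynomial.constantCoeff))

/-- The partial derivative with respect to `x`. -/
noncomputable def dx (f : BiSeries) : BiSeries :=
  PowerSeries.mk fun n => Polynomial.derivative (PowerSeries.coeff n f)

lemma dx_add (f g : BiSeries) : dx (f + g) = dx f + dx g := by
  ext n : 1
  simp [dx]

lemma dx_sub (f g : BiSeries) : dx (f - g) = dx f - dx g := by
  ext n : 1
  simp [dx]

lemma dx_mul (f g : BiSeries) : dx (f * g) = dx f * g + f * dx g := by
  ext n : 1
  simp only [dx, PowerSeries.coeff_mk, map_add, PowerSeries.coeff_mul, Polynomial.derivative_sum,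
    Polynomial.derivative_mul, Finset.sum_add_distrib]

@[simp] lemma dx_x : dx x = 1 := by
  ext n : 1
  simp only [dx, x, PowerSeries.coeff_mk, PowerSeries.coeff_C, PowerSeries.coeff_one]
  split_ifs <;> simp

@[simp] lemma dx_t : dx t = 0 := by
  ext n : 1
  simp only [dx, t, PowerSeries.coeff_mk, PowerSeries.coeff_X]
  split_ifs <;> simp

lemma dx_ex (f : BiSeries) : dx (ex f) = 0 := by
  ext n : 1
  simp [dx, ex, polyX0_apply]

@[simp] lemma dx_one : dx 1 = 0 := by simpa using dx_ex 1

@[simp] lemma dx_ofNat (n : ℕ) [n.AtLeastTwo] : dx ofNat(n) = 0 := by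
  have := dx_ex (ofNat(n))
  rwa [map_ofNat] at this

@[simp] lemma spec_x (e : ℚ) : spec e x = PowerSeries.C e := by simp [spec, x]

@[simp] lemma spec_t (e : ℚ) : spec e t = PowerSeries.X := by simp [spec, t]

lemma spec_ex_ey (e : ℚ) (f : BiSeries) : spec e (ex (ey f)) = corner f := by
  ext n
  simp [spec, ex, ey, corner, polyX0_apply, coeff_polyY0]

/-- The generating function `1 - 2 t ^ 2 S` with `S` counting reflected walks that end at
`(1,0)`. -/
noncomputable def lam : ℚ⟦X⟧ := 1 - 2 * X ^ 2 * corner (divx reflected)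

/-- The generating function `2 t (A + S)` with `A` and `S` counting killed and reflected walks
that end at `(1,0)`. -/
noncomputable def cee : ℚ⟦X⟧ := 2 * X * (corner (divx killed) + corner (divx reflected))

theorem exists_double_point (e : ℚ) (he : e ^ 2 = 1) : ∃ L : ℚ⟦X⟧, constantCoeff L = e ∧
    4 * X * L ^ 2 - 2 * X * cee * L - cee * lam = 0 ∧
    (2 * X * L - lam) ^ 2 * (L - cee) = (1 - 4 * X * C e) ^ 2 * L := by
  have hC : (C e : ℚ⟦X⟧) ^ 2 = 1 := by rw [← map_pow, he, map_one]
  have V := congrArg (spec e) killedRow_equation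
  have D := congrArg (spec e) (congrArg dx killedRow_equation)
  simp only [sq, dx_mul, dx_sub, dx_add, dx_x, dx_t, dx_one, dx_ofNat, killedCorner, dx_ex,
    reflectedCorner] at D
  simp only [map_mul, map_add, map_sub, map_pow, map_ofNat, map_one, map_zero, spec_x, spec_t,
    killedCorner, reflectedCorner, spec_ex_ey] at D V
  have h0 : constantCoeff (spec e killedRow) = 1 := by simp [killedRow]
  have h1 : constantCoeff (spec e (dx killedRow)) = 0 := by
    simp [killedRow, dx_add, dx_mul]
  set p := spec e killedRow
  set q := spec e (dx killedRow)
  have hl0 : constantCoeff lam = 1 := by simp [lam]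
  have hL0 : constantCoeff (C e * p) = e := by simp [h0]
  have hp : p = C e * (C e * p) := by linear_combination -p * hC
  obtain ⟨L, hL⟩ : ∃ L, L = C e * p := ⟨_, rfl⟩
  obtain ⟨M, hM⟩ : ∃ M, M = C e * q - p := ⟨_, rfl⟩
  rw [← hL] at hL0 hp
  have hq : q = C e * M + L := by rw [hM, hL]; linear_combination -q * hC
  have hM0 : M ≠ 0 := by
    intro h
    have := congrArg constantCoeff h
    simp [hM, h0, h1] at this
  have hQ0 : 2 * X * L - lam ≠ 0 := by
    intro h
    have := congrArg constantCoeff h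
    simp [hl0] at this
  have hV : (2 * X * L - lam) ^ 2 * (L - cee) = (1 - 4 * X * C e) ^ 2 * L := by
    rw [hp] at V
    rw [lam, cee]
    rcases sq_eq_one_iff.mp he with rfl | rfl
    · simp only [map_one] at V ⊢
      linear_combination V
    · simp only [map_one, map_neg] at V ⊢
      linear_combination -V
  have hD : (2 * X * L - lam) ^ 2 + 4 * X * (L - cee) * (2 * X * L - lam)
      = (1 - 4 * X * C e) ^ 2 := by
    apply mul_left_cancel₀ hM0
    rw [hp, hq] at D
    rw [lam, cee] at hV ⊢
    rcases sq_eq_one_iff.mp he with rfl | rfl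
    · simp only [map_one] at D hV ⊢
      linear_combination D - 3 * hV
    · simp only [map_one, map_neg] at D hV ⊢
      linear_combination -D + 3 * hV
  refine ⟨L, hL0, ?_, hV⟩
  apply mul_left_cancel₀ hQ0
  linear_combination L * hD - hV

theorem exists_parametrization : ∃ v : ℚ⟦X⟧, constantCoeff v = 1 ∧
    lam ^ 2 * (3 - v) ^ 3 * (1 + v) = 16 ∧
    lam ^ 2 * (3 + v) ^ 3 * (1 - v) = 256 * X ^ 2 ∧
    2 * X * cee = lam * (1 - v ^ 2) := by
  obtain ⟨P, hP0, hP, hP'⟩ := exists_double_point 1 (by norm_num)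
  obtain ⟨M, hM0, hM, hM'⟩ := exists_double_point (-1) (by norm_num)
  have : CharZero ℚ⟦X⟧ := algebraRat.charZero _
  rw [map_one] at hP'
  rw [map_neg, map_one] at hM'
  have hl0 : constantCoeff lam = 1 := by simp [lam]
  set l := lam
  set c := cee
  have hc : c = 2 * (P + M) := by
    have h1 : P - M ≠ 0 := by
      intro h
      have := congrArg constantCoeff h
      norm_num [hP0, hM0] at this
    have h2 : (2 * X : ℚ⟦X⟧) ≠ 0 := mul_ne_zero two_ne_zero X_ne_zero
    apply mul_left_cancel₀ (mul_ne_zero h1 h2)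
    linear_combination hM - hP
  have hcl : c * l = -4 * X * P * M := by
    rw [hc] at hP ⊢
    linear_combination -hP
  have hunit (L : ℚ⟦X⟧) : ∃ u, (l - 2 * X * L) * u = 1 ∧ constantCoeff u = 1 := by
    refine ⟨(l - 2 * X * L)⁻¹, PowerSeries.mul_inv_cancel _ ?_, ?_⟩ <;> simp [hl0]
  obtain ⟨u, hu, hu0⟩ := hunit P
  obtain ⟨w, hw, hw0⟩ := hunit M
  obtain ⟨a, ha⟩ : ∃ a, a = (1 - 4 * X) * u := ⟨_, rfl⟩
  obtain ⟨b, hb⟩ : ∃ b, b = (1 + 4 * X) * w := ⟨_, rfl⟩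
  have ha0 : constantCoeff a = 1 := by simp [ha, hu0]
  have hb0 : constantCoeff b = 1 := by simp [hb, hw0]
  replace hu : (l - 2 * X * P) * a = 1 - 4 * X := by rw [ha]; linear_combination (1 - 4 * X) * hu
  replace hw : (l - 2 * X * M) * b = 1 + 4 * X := by rw [hb]; linear_combination (1 + 4 * X) * hw
  have hQ (L : ℚ⟦X⟧) : l - 2 * X * L ≠ 0 := by
    intro h
    have := congrArg constantCoeff h
    simp [hl0] at this
  have hPa : P - c = a ^ 2 * P := by
    apply mul_left_cancel₀ (pow_ne_zero 2 (hQ P))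
    linear_combination hP' - ((l - 2 * X * P) * a + (1 - 4 * X)) * P * hu
  have hMb : M - c = b ^ 2 * M := by
    apply mul_left_cancel₀ (pow_ne_zero 2 (hQ M))
    linear_combination hM' - ((l - 2 * X * M) * b + (1 + 4 * X)) * M * hw
  have hPne : P ≠ 0 := by
    intro h
    simp [h] at hP0
  have hMne : M ≠ 0 := by
    intro h
    simp [h] at hM0
  have hab : (1 + a ^ 2) * (1 + b ^ 2) = 4 := by
    apply mul_left_cancel₀ hPne
    rw [hc] at hPa hMb
    linear_combination -(1 + b ^ 2) * hPa + 2 * hMb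
  have ea : 2 * X * P * (1 + a ^ 2) = l * (1 - a ^ 2) := by
    apply mul_left_cancel₀ hPne
    rw [hc] at hPa hcl
    linear_combination -hcl - (l + 2 * X * P) * hPa
  have eb : 2 * X * M * (1 + b ^ 2) = l * (1 - b ^ 2) := by
    apply mul_left_cancel₀ hMne
    rw [hc] at hMb hcl
    linear_combination -hcl - (l + 2 * X * M) * hMb
  have ha3 : l * a ^ 3 * (1 + b ^ 2) = 2 * (1 - 4 * X) := by
    apply mul_left_cancel₀ (two_ne_zero (α := ℚ⟦X⟧))
    linear_combination (1 + b ^ 2) * (1 + a ^ 2) * hu + (1 + b ^ 2) * a * ea + (1 - 4 * X) * hab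
  have hb3 : l * b ^ 3 * (1 + a ^ 2) = 2 * (1 + 4 * X) := by
    apply mul_left_cancel₀ (two_ne_zero (α := ℚ⟦X⟧))
    linear_combination (1 + a ^ 2) * (1 + b ^ 2) * hw + (1 + a ^ 2) * b * eb + (1 + 4 * X) * hab
  have hs : (a + b) ^ 2 = (3 - a * b) * (1 + a * b) := by linear_combination hab
  have hd : (b - a) ^ 2 = (3 + a * b) * (1 - a * b) := by linear_combination hab
  have hls : l * (a + b) * (3 - a * b) = 4 := by
    linear_combination ha3 + hb3 - l * (a + b) * hs
  have hld : l * (b - a) * (3 + a * b) = 16 * X := by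
    linear_combination hb3 - ha3 - l * (b - a) * hs
  refine ⟨a * b, by simp [ha0, hb0], ?_, ?_, ?_⟩
  · linear_combination (l * (a + b) * (3 - a * b) + 4) * hls - l ^ 2 * (3 - a * b) ^ 2 * hs
  · linear_combination (l * (b - a) * (3 + a * b) + 16 * X) * hld - l ^ 2 * (3 + a * b) ^ 2 * hd
  · have hne : 1 + a ^ 2 ≠ 0 := by
      intro h
      have := congrArg constantCoeff h
      norm_num [ha0] at this
    apply mul_left_cancel₀ hne
    linear_combination (1 - a ^ 2) * ea - 2 * X * (1 + a ^ 2) * hPa + l * a ^ 2 * hab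

/-- The Euler derivation `t d/dt`. -/
noncomputable def euler : Derivation ℚ ℚ⟦X⟧ ℚ⟦X⟧ := (X : ℚ⟦X⟧) • PowerSeries.derivative ℚ

lemma coeff_euler (f : ℚ⟦X⟧) (n : ℕ) : coeff n (euler f) = n * coeff n f := by
  rw [euler, Derivation.smul_apply, smul_eq_mul]
  cases n with
  | zero => simp
  | succ n =>
    rw [coeff_succ_X_mul, coeff_derivative]
    push_cast
    ring

@[simp] lemma euler_X : euler X = X := by simp [euler]

@[simp] lemma euler_ofNat (n : ℕ) [n.AtLeastTwo] : euler ofNat(n) = 0 :=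
  euler.map_natCast n

lemma euler_parametrization {l v : ℚ⟦X⟧} (hv : constantCoeff v = 1)
    (h₁ : l ^ 2 * (3 - v) ^ 3 * (1 + v) = 16)
    (h₂ : l ^ 2 * (3 + v) ^ 3 * (1 - v) = 256 * X ^ 2) :
    4 * v * euler l = -(l * (3 + v) * (1 - v)) ∧
    8 * v ^ 2 * euler v = -((9 - v ^ 2) * (1 - v ^ 2)) := by
  have : CharZero ℚ⟦X⟧ := algebraRat.charZero _
  have e1 := congrArg euler h₁
  have e2 := congrArg euler h₂
  simp only [Derivation.leibniz, Derivation.leibniz_pow, map_sub, map_add, euler_ofNat, smul_eq_mul,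
    Derivation.map_one_eq_zero, euler_X, nsmul_eq_mul] at e1 e2
  push_cast at e1 e2
  have hl : l ≠ 0 := by
    rintro rfl
    norm_num at h₁
  have hm : 3 - v ≠ 0 := by
    intro h
    have := congrArg constantCoeff h
    norm_num [hv, map_ofNat] at this
  have hp : 3 + v ≠ 0 := by
    intro h
    have := congrArg constantCoeff h
    norm_num [hv, map_ofNat] at this
  have f1 : euler l * (3 - v) * (1 + v) = 2 * l * v * euler v := by
    apply mul_left_cancel₀ (mul_ne_zero (mul_ne_zero two_ne_zero hl) (pow_ne_zero 2 hm))
    linear_combination e1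
  have f2 : euler l * (3 + v) * (1 - v) - 2 * l * v * euler v = l * (3 + v) * (1 - v) := by
    apply mul_left_cancel₀ (mul_ne_zero (mul_ne_zero two_ne_zero hl) (pow_ne_zero 2 hp))
    linear_combination e2 - 2 * h₂
  have f3 : 4 * v * euler l = -(l * (3 + v) * (1 - v)) := by
    linear_combination f1 - f2
  refine ⟨f3, ?_⟩
  apply mul_left_cancel₀ hl
  linear_combination -4 * v * f1 + (3 - v) * (1 + v) * f3

lemma sixteen_X_sq_mul {l v : ℚ⟦X⟧} (h₁ : l ^ 2 * (3 - v) ^ 3 * (1 + v) = 16)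
    (h₂ : l ^ 2 * (3 + v) ^ 3 * (1 - v) = 256 * X ^ 2) :
    16 * X ^ 2 * ((3 - v) ^ 3 * (1 + v)) = (3 + v) ^ 3 * (1 - v) := by
  have : CharZero ℚ⟦X⟧ := algebraRat.charZero _
  apply mul_left_cancel₀ (OfNat.ofNat_ne_zero 16 : (16 : ℚ⟦X⟧) ≠ 0)
  linear_combination (3 + v) ^ 3 * (1 - v) * h₁ - (3 - v) ^ 3 * (1 + v) * h₂

lemma euler_first {l v : ℚ⟦X⟧} (hv : constantCoeff v = 1)
    (h₁ : l ^ 2 * (3 - v) ^ 3 * (1 + v) = 16)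
    (h₂ : l ^ 2 * (3 + v) ^ 3 * (1 - v) = 256 * X ^ 2) :
    3 * euler (euler (l * (3 + v ^ 2))) - 4 * euler (l * (3 + v ^ 2)) =
    16 * X ^ 2 * (3 * euler (euler (l * (3 + v ^ 2))) - 2 * euler (l * (3 + v ^ 2))
      - l * (3 + v ^ 2)) := by
  have : CharZero ℚ⟦X⟧ := algebraRat.charZero _
  obtain ⟨el, ev⟩ := euler_parametrization hv h₁ h₂
  have hX := sixteen_X_sq_mul h₁ h₂
  have hv0 : v ≠ 0 := by
    rintro rfl
    norm_num at hv
  have hm : (3 - v) ^ 3 * (1 + v) ≠ 0 := by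
    intro h
    have := congrArg constantCoeff h
    norm_num [hv, map_ofNat] at this
  obtain ⟨f, hf⟩ : ∃ f, f = l * (3 + v ^ 2) := ⟨_, rfl⟩
  have d1 := congrArg euler hf
  simp only [Derivation.leibniz, Derivation.leibniz_pow, map_add, euler_ofNat, smul_eq_mul,
    nsmul_eq_mul] at d1
  push_cast at d1
  have g1 : 2 * v * euler f = -(l * (3 + v) ^ 2 * (1 - v)) := by
    apply mul_left_cancel₀ (mul_ne_zero two_ne_zero hv0)
    linear_combination 4 * v ^ 2 * d1 + v * (3 + v ^ 2) * el + l * v * ev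
  have d2 := congrArg euler g1
  simp only [Derivation.leibniz, Derivation.leibniz_pow, map_add, map_neg, map_sub, euler_ofNat,
    smul_eq_mul, Derivation.map_one_eq_zero, nsmul_eq_mul] at d2
  push_cast at d2
  have g2 : 16 * v ^ 4 * euler (euler f) =
      -(l * (3 + v) ^ 2 * (1 - v) * (9 * v ^ 3 - 5 * v ^ 2 + 3 * v + 9)) := by
    linear_combination 8 * v ^ 3 * d2 - 2 * v * euler f * ev
      - 2 * v ^ 2 * ((3 + v) ^ 2 * (1 - v)) * el + l * v * (3 + 10 * v + 3 * v ^ 2) * ev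
      + (9 - v ^ 2) * (1 - v ^ 2) * g1
  rw [← hf]
  apply mul_left_cancel₀ (mul_ne_zero (mul_ne_zero (OfNat.ofNat_ne_zero 16) (pow_ne_zero 4 hv0)) hm)
  linear_combination (3 - v) ^ 3 * (1 + v) * (3 * g2 - 32 * v ^ 3 * g1)
    - (3 + v) ^ 3 * (1 - v) * (3 * g2 - 16 * v ^ 3 * g1 - 16 * v ^ 4 * hf)
    - 16 * v ^ 4 * (3 * euler (euler f) - 2 * euler f - f) * hX

lemma euler_second {l v : ℚ⟦X⟧} (hv : constantCoeff v = 1)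
    (h₁ : l ^ 2 * (3 - v) ^ 3 * (1 + v) = 16)
    (h₂ : l ^ 2 * (3 + v) ^ 3 * (1 - v) = 256 * X ^ 2) :
    3 * euler (euler (l * (3 - v ^ 2))) - 2 * euler (l * (3 - v ^ 2)) =
    16 * X ^ 2 * (3 * euler (euler (l * (3 - v ^ 2))) - 4 * euler (l * (3 - v ^ 2))
      + l * (3 - v ^ 2)) := by
  have : CharZero ℚ⟦X⟧ := algebraRat.charZero _
  obtain ⟨el, ev⟩ := euler_parametrization hv h₁ h₂
  have hX := sixteen_X_sq_mul h₁ h₂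
  have hv0 : v ≠ 0 := by
    rintro rfl
    norm_num at hv
  have hm : (3 - v) ^ 3 * (1 + v) ≠ 0 := by
    intro h
    have := congrArg constantCoeff h
    norm_num [hv, map_ofNat] at this
  obtain ⟨f, hf⟩ : ∃ f, f = l * (3 - v ^ 2) := ⟨_, rfl⟩
  have d1 := congrArg euler hf
  simp only [Derivation.leibniz, Derivation.leibniz_pow, map_sub, euler_ofNat, smul_eq_mul,
    nsmul_eq_mul] at d1
  push_cast at d1
  have g1 : 2 * euler f = l * (3 + v) * (1 - v) := by
    apply mul_left_cancel₀ (mul_ne_zero two_ne_zero (pow_ne_zero 2 hv0))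
    linear_combination 4 * v ^ 2 * d1 + v * (3 - v ^ 2) * el - l * v * ev
  have d2 := congrArg euler g1
  simp only [Derivation.leibniz, map_add, map_sub, euler_ofNat, smul_eq_mul,
    Derivation.map_one_eq_zero] at d2
  have g2 : 8 * v ^ 2 * euler (euler f) = l * (3 + v) * (1 - v) * (3 + 2 * v + 3 * v ^ 2) := by
    linear_combination 4 * v ^ 2 * d2 + v * (3 + v) * (1 - v) * el - l * (1 + v) * ev
  rw [← hf]
  apply mul_left_cancel₀ (mul_ne_zero (mul_ne_zero (OfNat.ofNat_ne_zero 8) (pow_ne_zero 2 hv0)) hm)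
  linear_combination (3 - v) ^ 3 * (1 + v) * (3 * g2 - 8 * v ^ 2 * g1)
    - (3 + v) ^ 3 * (1 - v) * (3 * g2 - 16 * v ^ 2 * g1 + 8 * v ^ 2 * hf)
    - 8 * v ^ 2 * (3 * euler (euler f) - 4 * euler f + f) * hX

end BiSeries

lemma poch_succ (a : ℚ) (n : ℕ) : poch a (n + 1) = poch a n * (a + n) := by
  simp [poch, ascPochhammer_succ_right]

lemma poch_pos {a : ℚ} (ha : 0 < a) (n : ℕ) : 0 < poch a n := ascPochhammer_pos n a ha

lemma eq_of_hypergeometric_recurrence {u : ℕ → ℚ} {a b c z : ℚ} (hc : 0 < c)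
    (h : ∀ n : ℕ, (n + 1) * (n + c) * u (n + 1) = z * ((n + a) * (n + b)) * u n) (n : ℕ) :
    u (n + 1) = z * a * b / c * u 0 * z ^ n *
      (poch (a + 1) n * poch (b + 1) n / (poch 2 n * poch (c + 1) n)) := by
  induction n with
  | zero =>
    have := h 0
    simp only [poch, ascPochhammer_zero, Polynomial.eval_one]
    push_cast at this
    field_simp
    linear_combination this
  | succ n ih =>
    have h1 := h (n + 1)
    have p1 := poch_pos (a := 2) (by norm_num) n
    have p2 := poch_pos (a := c + 1) (by linarith) n
    rw [ih] at h1
    push_cast at h1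
    simp only [poch_succ]
    have q1 : (n + 1 + 1 : ℚ) * (n + 1 + c) ≠ 0 := by positivity
    apply mul_left_cancel₀ q1
    rw [h1]
    have q2 : (2 + n : ℚ) ≠ 0 := by positivity
    have q3 : (c + 1 + n : ℚ) ≠ 0 := by positivity
    field_simp
    ring

namespace BiSeries

open PowerSeries

theorem coeff_corner_sub (n : ℕ) :
    coeff (2 * n) (corner (divx reflected) - corner (divx killed)) =
      4 * 16 ^ n / 3 *
        ((poch (1/2) n * poch (7/6) n) / (poch 2 n * poch (4/3) n)
          - (poch (1/2) n * poch (5/6) n) / (poch 2 n * poch (5/3) n)) := by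
  obtain ⟨v, hv, h₁, h₂, h₃⟩ := exists_parametrization
  have hl0 : constantCoeff lam = 1 := by simp [lam]
  have hsum : 12 * X ^ 2 * (corner (divx reflected) - corner (divx killed)) =
      12 - lam * (3 + v ^ 2) - 4 * (lam * (3 - v ^ 2)) := by
    have h₄ := h₃
    rw [cee] at h₄
    have h₅ : lam = 1 - 2 * X ^ 2 * corner (divx reflected) := rfl
    linear_combination 12 * h₅ - 3 * h₄
  have key (f : ℚ⟦X⟧) (k : ℕ) : coeff (k + 2) (16 * X ^ 2 * f) = 16 * coeff k f := by
    rw [mul_comm 16, mul_assoc, coeff_X_pow_mul, ← map_ofNat C, coeff_C_mul]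
  have hmul (m : ℕ) (f : ℚ⟦X⟧) (k : ℕ) [m.AtLeastTwo] :
      coeff k (ofNat(m) * f) = ofNat(m) * coeff k f := by
    rw [← map_ofNat C, coeff_C_mul]
  have hH := eq_of_hypergeometric_recurrence (u := fun n => coeff (2 * n) (lam * (3 + v ^ 2)))
    (a := -1/2) (b := 1/6) (c := 1/3) (z := 16) (by norm_num) (fun k => by
      have := congrArg (coeff (2 * k + 2)) (euler_first hv h₁ h₂)
      rw [key] at this
      simp only [map_sub, hmul, coeff_euler] at this
      push_cast at this
      rw [show 2 * (k + 1) = 2 * k + 2 by ring]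
      linear_combination this / 12) n
  have hK := eq_of_hypergeometric_recurrence (u := fun n => coeff (2 * n) (lam * (3 - v ^ 2)))
    (a := -1/2) (b := -1/6) (c := 2/3) (z := 16) (by norm_num) (fun k => by
      have := congrArg (coeff (2 * k + 2)) (euler_second hv h₁ h₂)
      rw [key] at this
      simp only [map_sub, map_add, hmul, coeff_euler] at this
      push_cast at this
      rw [show 2 * (k + 1) = 2 * k + 2 by ring]
      linear_combination this / 12) n
  have hc := congrArg (coeff (2 * n + 2)) hsum
  have h12 : coeff (2 * n + 2) (12 : ℚ⟦X⟧) = 0 := by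
    rw [← map_ofNat C, coeff_C, if_neg (by omega)]
  rw [mul_assoc, hmul, coeff_X_pow_mul, map_sub, map_sub, map_sub, h12, hmul] at hc
  have hH0 : coeff 0 (lam * (3 + v ^ 2)) = 4 := by norm_num [hv, hl0, map_ofNat]
  have hK0 : coeff 0 (lam * (3 - v ^ 2)) = 2 := by norm_num [hv, hl0, map_ofNat]
  simp only [mul_zero, show 2 * (n + 1) = 2 * n + 2 by ring, hH0, hK0] at hH hK
  norm_num at hH hK
  rw [hH, hK] at hc
  rw [map_sub]
  linear_combination hc / 12

end BiSeries

section Walks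

variable {steps region : Set (ℤ × ℤ)} {a b : ℤ × ℤ}

/-- The walks counted by `walkCount`. -/
abbrev Walks (steps region : Set (ℤ × ℤ)) (a b : ℤ × ℤ) (n : ℕ) : Type :=
  {w : Fin (n + 1) → ℤ × ℤ // w 0 = a ∧ w (Fin.last n) = b ∧
    (∀ k : Fin n, w k.succ - w k.castSucc ∈ steps) ∧ ∀ k, w k ∈ region}

/-- Append a step to a walk. -/
def Walks.append (hb : b ∈ region) (n : ℕ) (v : Σ s : steps, Walks steps region a (b - s) n) :
    Walks steps region a b (n + 1) :=
  ⟨Fin.snoc v.2.1 b, by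
    obtain ⟨⟨s, hs⟩, w, h0, hl, hw, hr⟩ := v
    refine ⟨?_, by simp, fun k => ?_, fun k => ?_⟩
    · change Fin.snoc (α := fun _ => ℤ × ℤ) w b (Fin.castSucc 0) = a
      rw [Fin.snoc_castSucc, h0]
    · induction k using Fin.lastCases with
      | last => simpa [hl] using hs
      | cast k =>
        rw [Fin.succ_castSucc, Fin.snoc_castSucc, Fin.snoc_castSucc]
        exact hw k
    · induction k using Fin.lastCases with
      | last => simpa using hb
      | cast k => simpa using hr k⟩

lemma Walks.append_bijective (hb : b ∈ region) (n : ℕ) :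
    Function.Bijective (Walks.append (steps := steps) (a := a) hb n) := by
  constructor
  · rintro ⟨⟨s, hs⟩, w, h0, hl, hw, hr⟩ ⟨⟨s', hs'⟩, w', h0', hl', hw', hr'⟩ h
    have h' := congrArg (fun v => Fin.init (α := fun _ => ℤ × ℤ) v.1) h
    simp only [Walks.append, Fin.init_snoc] at h'
    subst h'
    obtain rfl : s = s' := by
      rw [hl] at hl'
      simpa using hl'
    rfl
  · rintro ⟨w, h0, hl, hw, hr⟩
    refine ⟨⟨⟨_, hw (Fin.last n)⟩, Fin.init w, h0, ?_, fun k => hw k.castSucc, fun k => hr _⟩, ?_⟩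
    · change w (Fin.last n).castSucc = b - (w (Fin.last (n + 1)) - w (Fin.last n).castSucc)
      rw [hl, sub_sub_cancel]
    · apply Subtype.ext
      simp only [Walks.append]
      rw [← hl, Fin.snoc_init_self]

lemma Walks.finite (hs : steps.Finite) (n : ℕ) : ∀ b, Finite (Walks steps region a b n) := by
  induction n with
  | zero =>
    intro b
    have : Subsingleton (Walks steps region a b 0) := ⟨fun w w' => Subtype.ext <| funext fun k => by
      rw [Fin.fin_one_eq_zero k, w.2.1, w'.2.1]⟩
    infer_instance
  | succ n ih =>
    intro b
    by_cases hb : b ∈ region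
    · have := hs.to_subtype
      exact Finite.of_surjective _ (Walks.append_bijective hb n).2
    · have : IsEmpty (Walks steps region a b (n + 1)) := ⟨fun w => hb (w.2.2.1 ▸ w.2.2.2.2 _)⟩
      infer_instance

lemma walkCount_zero (ha : a ∈ region) : walkCount steps region a b 0 = if b = a then 1 else 0 := by
  split_ifs with h
  · subst h
    have : Unique (Walks steps region b b 0) :=
      { default := ⟨fun _ => b, rfl, rfl, fun k => k.elim0, fun _ => ha⟩
        uniq := fun w => Subtype.ext <| funext fun k => by rw [Fin.fin_one_eq_zero k, w.2.1] }
    exact Nat.card_unique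
  · have : IsEmpty (Walks steps region a b 0) := ⟨fun w => h (w.2.2.1.symm.trans w.2.1)⟩
    exact Nat.card_of_isEmpty

lemma walkCount_eq_zero (hb : b ∉ region) (n : ℕ) : walkCount steps region a b n = 0 := by
  have : IsEmpty (Walks steps region a b n) := ⟨fun w => hb (w.2.2.1 ▸ w.2.2.2.2 _)⟩
  exact Nat.card_of_isEmpty

lemma walkCount_succ (S : Finset (ℤ × ℤ)) (hb : b ∈ region) (n : ℕ) :
    walkCount S region a b (n + 1) = ∑ s ∈ S, walkCount S region a (b - s) n := by
  have (s : (S : Set (ℤ × ℤ))) := Walks.finite (region := region) (a := a) S.finite_toSet n (b - s)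
  rw [walkCount, ← Nat.card_congr (Equiv.ofBijective _ (Walks.append_bijective hb n)),
    Nat.card_sigma]
  exact Finset.sum_coe_sort S fun s => walkCount S region a (b - s) n

end Walks

/-- Square-lattice walks in the three-quadrant cone from `(-1,0)` to `(i,j)`. -/
noncomputable def coneCount (n : ℕ) (i j : ℤ) : ℚ := walkCount squareSteps coneC (-1, 0) (i, j) n

lemma coneCount_zero (i j : ℤ) : coneCount 0 i j = if i = -1 ∧ j = 0 then 1 else 0 := by
  rw [coneCount, walkCount_zero (by simp [coneC])]
  simp

lemma coneCount_eq_zero {i j : ℤ} (hi : i < 0) (hj : j < 0) (n : ℕ) : coneCount n i j = 0 := by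
  rw [coneCount, walkCount_eq_zero (by simp [coneC]; omega), Nat.cast_zero]

lemma coneCount_succ {i j : ℤ} (h : 0 ≤ i ∨ 0 ≤ j) (n : ℕ) :
    coneCount (n + 1) i j = coneCount n (i - 1) j + coneCount n (i + 1) j + coneCount n i (j - 1)
      + coneCount n i (j + 1) := by
  have hS : squareSteps =
      (({(1, 0), (-1, 0), (0, 1), (0, -1)} : Finset (ℤ × ℤ)) : Set (ℤ × ℤ)) := by
    simp [squareSteps]
  simp only [coneCount]
  rw [hS, walkCount_succ _ (show (i, j) ∈ coneC from h)]
  simp [add_assoc]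

namespace BiSeries

lemma coeff_walkPoly {τ : ℚ} (hτ : τ ^ 2 = 1) (n : ℕ) : ∀ i j : ℕ,
    ((walkPoly τ n).coeff i).coeff j = coneCount n (j - i) j + τ * coneCount n j (j - i) := by
  induction n with
  | zero =>
    intro i j
    simp only [walkPoly, coneCount_zero, Polynomial.coeff_X]
    have : ¬ ((j : ℤ) = -1 ∧ (j : ℤ) - i = 0) := by omega
    rw [if_neg this, mul_zero, add_zero]
    rcases eq_or_ne i 1 with rfl | hi
    · rcases eq_or_ne j 0 with rfl | hj
      · simp
      · rw [if_pos rfl, Polynomial.coeff_one, if_neg hj, if_neg (by omega)]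
    · rw [if_neg hi.symm, Polynomial.coeff_zero, if_neg (by omega)]
  | succ n ih =>
    intro i j
    rw [coneCount_succ (by omega), coneCount_succ (by omega)]
    cases i with
    | zero =>
      simp [walkPoly, stepPoly, coeff_divY, polyX0_apply, Polynomial.mul_coeff_zero, ih]
      linear_combination (coneCount n j (j - 1) + coneCount n (j + 1) j) * hτ
    | succ i =>
      cases j with
      | zero =>
        simp [walkPoly, stepPoly, coeff_divY, polyX0_apply, ih]
        rw [coneCount_eq_zero (show (-1 + -(i : ℤ)) < 0 by omega) (show (-1 : ℤ) < 0 by omega),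
          coneCount_eq_zero (show (-1 : ℤ) < 0 by omega) (show (-1 + -(i : ℤ)) < 0 by omega),
          show (-1 + -(i : ℤ) - 1) = -1 + (-1 + -i) by ring]
        ring
      | succ j =>
        simp [walkPoly, stepPoly, coeff_divY, polyX0_apply, ih]
        rw [show (j : ℤ) + 1 - i = j - i + 1 by ring, show (j : ℤ) - (i + 1) = j - i - 1 by ring]
        ring

lemma coeff_corner_sub_eq_coneCount (n : ℕ) :
    PowerSeries.coeff n (corner (divx reflected) - corner (divx killed)) =
      2 * coneCount n 0 (-1) := by
  have h1 := coeff_walkPoly (τ := 1) (by norm_num) n 1 0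
  have h2 := coeff_walkPoly (τ := -1) (by norm_num) n 1 0
  simp [corner, divx, reflected, killed, walkSeries, ex, polyX0_apply, h1, h2]
  ring

end BiSeries

theorem square_threeQuadrant_minusOne_to_belowOne_count (n : ℕ) :
    (walkCount squareSteps coneC (-1, 0) (0, -1) (2*n) : ℚ) =
      2 * 16^n / 3 *
        ((poch (1/2) n * poch (7/6) n) / (poch 2 n * poch (4/3) n)
          - (poch (1/2) n * poch (5/6) n) / (poch 2 n * poch (5/3) n)) := by
  have h := BiSeries.coeff_corner_sub n
  rw [BiSeries.coeff_corner_sub_eq_coneCount, coneCount] at h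
  linear_combination h / 2
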